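/- arXiv:2312.16961 — 2 statements merged into one kernel-verified Lean document; each statement's English description precedes it below -/
import Mathlib

section
/- Let d = m + n ≥ 2, let ω be an (m,n)-weight vector, let k ∈ {1,…,d−1}, and let Λ ⊂ ℝ^d be a unimodular lattice. Suppose that for every k-dimensional linear subspace W spanned by vectors of Λ, the largest eigenvalue appearing in the decomposition of v_W into eigenvectors of a_1^ω in ⋀^k ℝ^d is strictly greater than 1 (equivalently, there exists I of cardinality k with μ_I > 0 whose e_I-coefficient in v_W is nonzero). Then L^ω(Λ,·) is connected at k. -/
open scoped Classical
open MeasureTheory Module Matrix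

noncomputable section

/-- The set of integer vectors in `ℝ^d`. -/
def intVectors (d : ℕ) : Set (Fin d → ℝ) :=
  Set.range fun z : Fin d → ℤ => fun i => (z i : ℝ)

/-- The lattice `g ℤ^d`. -/
def latticeOf {d : ℕ} (g : Matrix (Fin d) (Fin d) ℝ) : Set (Fin d → ℝ) :=
  g.mulVec '' intVectors d

/-- The `i`-th successive minimum of a lattice `Λ ⊆ ℝ^d` with respect to the closed unit
cube (the sup-norm unit ball): the least `r > 0` such that `r C` contains `i` linearly
independent vectors of `Λ`. -/
def succMin (d : ℕ) (Λ : Set (Fin d → ℝ)) (i : ℕ) : ℝ :=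
  sInf {r : ℝ | 0 < r ∧ ∃ v : Fin i → (Fin d → ℝ),
    (∀ j, v j ∈ Λ) ∧ LinearIndependent ℝ v ∧ ∀ j, ‖v j‖ ≤ r}

/-- `ω` is an `(m,n)`-weight vector. -/
def IsWeightVector (m n : ℕ) (ω : Fin (m + n) → ℝ) : Prop :=
  (∀ i, 0 < ω i) ∧
  (∀ i j : Fin (m + n), i ≤ j → (j : ℕ) < m → ω j ≤ ω i) ∧
  (∀ i j : Fin (m + n), m ≤ (i : ℕ) → i ≤ j → ω j ≤ ω i) ∧
  (∑ i ∈ Finset.univ.filter (fun i : Fin (m + n) => (i : ℕ) < m), ω i) = 1 ∧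
  (∑ i ∈ Finset.univ.filter (fun i : Fin (m + n) => m ≤ (i : ℕ)), ω i) = 1

/-- The signed weight: `ω i` for `i < m` (expanding directions) and `-ω i` for `i ≥ m`. -/
def signedWeight (m : ℕ) {d : ℕ} (ω : Fin d → ℝ) (i : Fin d) : ℝ :=
  if (i : ℕ) < m then ω i else -ω i

/-- The diagonal flow `a_t^ω = diag (e^{ω₁ t}, …, e^{ω_m t}, e^{-ω_{m+1} t}, …, e^{-ω_d t})`. -/
def aMat (m : ℕ) {d : ℕ} (ω : Fin d → ℝ) (t : ℝ) : Matrix (Fin d) (Fin d) ℝ :=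
  Matrix.diagonal fun i => Real.exp (signedWeight m ω i * t)

/-- `L_i^ω(Λ, t) = log λ_i (a_t^ω Λ)`. -/
def Lfun (m : ℕ) {d : ℕ} (ω : Fin d → ℝ) (Λ : Set (Fin d → ℝ)) (i : ℕ) (t : ℝ) : ℝ :=
  Real.log (succMin d ((aMat m ω t).mulVec '' Λ) i)

/-- `L^ω(Λ, ⬝)` is connected at `k`: the set `{t ≥ 0 : L_k = L_{k+1}}` is unbounded above. -/
def ConnectedAt (m : ℕ) {d : ℕ} (ω : Fin d → ℝ) (Λ : Set (Fin d → ℝ)) (k : ℕ) : Prop :=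
  ∀ T : ℝ, ∃ t : ℝ, 0 ≤ t ∧ T ≤ t ∧ Lfun m ω Λ k t = Lfun m ω Λ (k + 1) t

/-- `μ_I = ∑_{i ∈ I, i ≤ m} ω_i - ∑_{i ∈ I, i ≥ m+1} ω_i`. -/
def muI (m : ℕ) {d : ℕ} (ω : Fin d → ℝ) (I : Finset (Fin d)) : ℝ :=
  ∑ i ∈ I, signedWeight m ω i

/-- The orthogonal projection `π_I : ℝ^d → ℝ^I`. -/
def coordProj (d : ℕ) (I : Finset (Fin d)) : (Fin d → ℝ) →ₗ[ℝ] (Fin d → ℝ) where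
  toFun v := fun i => if i ∈ I then v i else 0
  map_add' u v := by funext i; by_cases h : i ∈ I <;> simp [h]
  map_smul' c v := by funext i; by_cases h : i ∈ I <;> simp [h]

/-- The coordinate subspace `ℝ^I = span {e_i : i ∈ I}`. -/
def coordSubspace (d : ℕ) (I : Finset (Fin d)) : Submodule ℝ (Fin d → ℝ) :=
  Submodule.span ℝ {v | ∃ i ∈ I, v = Pi.single i (1 : ℝ)}

/-- The coefficient of `e_I` in `w 0 ∧ ⋯ ∧ w (k-1) ∈ ⋀^k ℝ^d`, i.e. the `I`-rows minor
`det (w_{j i})_{j ∈ I, 1 ≤ i ≤ k}`. -/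
def gramCoeff {d k : ℕ} (w : Fin k → Fin d → ℝ) (I : Finset (Fin d)) : ℝ :=
  if h : I.card = k then
    Matrix.det (Matrix.of fun r c : Fin k => w c (I.orderEmbOfFin h r))
  else 0

/-- The minor `det A(I, J)` of a square matrix. -/
def subDet {d : ℕ} (A : Matrix (Fin d) (Fin d) ℝ) (k : ℕ) (I J : Finset (Fin d)) : ℝ :=
  if h : I.card = k ∧ J.card = k then
    Matrix.det (Matrix.of fun r c : Fin k => A (I.orderEmbOfFin h.1 r) (J.orderEmbOfFin h.2 c))
  else 0

/-- The largest eigenvalue of `a_1^ω` appearing in the decomposition of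
`w 0 ∧ ⋯ ∧ w (k-1)` into eigenvectors of `a_1^ω` in `⋀^k ℝ^d`. -/
def largestEigAlong (m : ℕ) {d k : ℕ} (ω : Fin d → ℝ) (w : Fin k → Fin d → ℝ) : ℝ :=
  sSup {r : ℝ | ∃ I : Finset (Fin d), I.card = k ∧ gramCoeff w I ≠ 0 ∧ r = Real.exp (muI m ω I)}

/-- `E_j = span (e_1, …, e_j)` (the first `j` coordinates, 0-indexed internally). -/
def Espan (d : ℕ) (j : ℕ) : Submodule ℝ (Fin d → ℝ) :=
  Submodule.span ℝ {v | ∃ i : Fin d, (i : ℕ) < j ∧ v = Pi.single i (1 : ℝ)}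

/-- `E'_{j+1} = span (e_{j+1}, …, e_m)` (0-indexed: coordinates `≥ j`). -/
def Eprime (m : ℕ) (j : ℕ) : Submodule ℝ (Fin m → ℝ) :=
  Submodule.span ℝ {v | ∃ i : Fin m, j ≤ (i : ℕ) ∧ v = Pi.single i (1 : ℝ)}

/-- `I(W) = {i ∈ {m+1,…,d} : dim (W ∩ E_i) > dim (W ∩ E_{i-1})}`. -/
def Iset (m : ℕ) {d : ℕ} (W : Submodule ℝ (Fin d → ℝ)) : Finset (Fin d) :=
  Finset.univ.filter fun i : Fin d =>
    m ≤ (i : ℕ) ∧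
      finrank ℝ ↥(W ⊓ Espan d (i : ℕ)) < finrank ℝ ↥(W ⊓ Espan d ((i : ℕ) + 1))

/-- `ψ(W) = ∑_{i ∈ I(W)} ω_i`. -/
def psiF (m : ℕ) {d : ℕ} (ω : Fin d → ℝ) (W : Submodule ℝ (Fin d → ℝ)) : ℝ :=
  ∑ i ∈ Iset m W, ω i

/-- `J(W') = {j ∈ {1,…,m} : dim (W' ∩ ⟨e_{j+1},…,e_m⟩) < dim (W' ∩ ⟨e_j,…,e_m⟩)}`. -/
def Jset {m : ℕ} (W' : Submodule ℝ (Fin m → ℝ)) : Finset (Fin m) :=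
  Finset.univ.filter fun j : Fin m =>
    finrank ℝ ↥(W' ⊓ Eprime m ((j : ℕ) + 1)) < finrank ℝ ↥(W' ⊓ Eprime m (j : ℕ))

/-- `φ(W') = ∑_{j ∈ J(W')} ω_j`. -/
def phiF (m n : ℕ) (ω : Fin (m + n) → ℝ) (W' : Submodule ℝ (Fin m → ℝ)) : ℝ :=
  ∑ j ∈ Jset W', ω (Fin.castAdd n j)

/-- `u(x) = [[Iₘ, x], [0, Iₙ]]`. -/
def uMat (m n : ℕ) (x : Matrix (Fin m) (Fin n) ℝ) : Matrix (Fin (m + n)) (Fin (m + n)) ℝ :=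
  Matrix.reindex finSumFinEquiv finSumFinEquiv (Matrix.fromBlocks 1 x 0 1)

/-- `x̃ ∈ M_{m,d}(ℝ)`: the first `m` rows of `u(x)`. -/
def xTil (m n : ℕ) (x : Matrix (Fin m) (Fin n) ℝ) : Matrix (Fin m) (Fin (m + n)) ℝ :=
  Matrix.of fun i j => uMat m n x (Fin.castAdd n i) j

/-- `ker x̃` as a subspace of `ℝ^d`. -/
def kerXtil (m n : ℕ) (x : Matrix (Fin m) (Fin n) ℝ) : Submodule ℝ (Fin (m + n) → ℝ) :=
  LinearMap.ker (xTil m n x).mulVecLin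

/-- The `k`-pencil `P^ω_{W,a,b} = {x : ψ(ker x̃ ∩ W) ≥ a ∧ φ(x̃ W) ≤ b}`. -/
def pencil (m n : ℕ) (ω : Fin (m + n) → ℝ) (W : Submodule ℝ (Fin (m + n) → ℝ)) (a b : ℝ) :
    Set (Matrix (Fin m) (Fin n) ℝ) :=
  {x | a ≤ psiF m ω (kerXtil m n x ⊓ W) ∧ phiF m n ω (W.map (xTil m n x).mulVecLin) ≤ b}

/-- A subspace of `ℝ^d` is rational (defined over `ℚ`) if it is spanned by rational vectors. -/
def IsRationalSubspace {d : ℕ} (W : Submodule ℝ (Fin d → ℝ)) : Prop :=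
  ∃ S : Set (Fin d → ℚ),
    Submodule.span ℝ ((fun q : Fin d → ℚ => fun i => ((q i : ℝ))) '' S) = W

/-- A subset of `M_{m,n}(ℝ)` is Zariski closed if it is the common zero locus of a set of
real polynomials in the matrix entries. -/
def IsZariskiClosed {m n : ℕ} (S : Set (Matrix (Fin m) (Fin n) ℝ)) : Prop :=
  ∃ P : Set (MvPolynomial (Fin m × Fin n) ℝ),
    S = {x | ∀ p ∈ P, MvPolynomial.eval (fun ij => x ij.1 ij.2) p = 0}

/-- View a point of Euclidean space indexed by matrix entries as a matrix. -/
def matOfEuc (m n : ℕ) (z : EuclideanSpace ℝ (Fin m × Fin n)) : Matrix (Fin m) (Fin n) ℝ :=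
  Matrix.of fun i j => z (i, j)

/-- `M` is a `p`-dimensional analytic submanifold: around every point, `M` agrees with the
image of an injective analytic immersion of an open subset of `ℝ^p`. -/
def IsAnalyticSubmanifold {ι : Type*} [Fintype ι] (p : ℕ) (M : Set (EuclideanSpace ℝ ι)) :
    Prop :=
  ∀ z ∈ M, ∃ (U : Set (EuclideanSpace ℝ (Fin p)))
      (f : EuclideanSpace ℝ (Fin p) → EuclideanSpace ℝ ι) (V : Set (EuclideanSpace ℝ ι)),
    IsOpen U ∧ IsOpen V ∧ z ∈ V ∧ AnalyticOnNhd ℝ f U ∧ Set.InjOn f U ∧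
      (∀ u ∈ U, Function.Injective (fderiv ℝ f u)) ∧ f '' U = M ∩ V

/-- A column matrix from a vector. -/
def colMat (m : ℕ) (ξ : Fin m → ℝ) : Matrix (Fin m) (Fin 1) ℝ :=
  Matrix.of fun i _ => ξ i

/-- A row matrix from a vector. -/
def rowMat (n : ℕ) (ξ : Fin n → ℝ) : Matrix (Fin 1) (Fin n) ℝ :=
  Matrix.of fun _ j => ξ j

/-- The minor of `x` with rows `P` and columns `Q`. -/
def minorDet (m n : ℕ) (x : Matrix (Fin m) (Fin n) ℝ) (P : Finset (Fin m))
    (Q : Finset (Fin n)) (h : P.card = Q.card) : ℝ :=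
  Matrix.det (Matrix.of fun r c : Fin P.card =>
    x (P.orderEmbOfFin rfl r) (Q.orderEmbOfFin h.symm c))

/-- `𝓓(𝓡)`: the set of all `p × p` minors of `x` with increasing rows in `{1,…,m}` and
increasing columns in `𝓡`, for `1 ≤ p ≤ min m (d - k)`. -/
def Dset (m n k : ℕ) (x : Matrix (Fin m) (Fin n) ℝ) (R : Finset (Fin n)) : Set ℝ :=
  {r | ∃ (P : Finset (Fin m)) (Q : Finset (Fin n)) (h : P.card = Q.card),
    Q ⊆ R ∧ 1 ≤ P.card ∧ P.card ≤ min m (m + n - k) ∧ r = minorDet m n x P Q h}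


/-- Minkowski's theorem on linear forms. -/
theorem exists_int_mulVec_abs_lt {d : ℕ} (A : Matrix (Fin d) (Fin d) ℝ) (hA : |A.det| = 1)
    (c : Fin d → ℝ) (hc : ∀ i, 0 < c i) (hprod : 1 < ∏ i, c i) :
    ∃ z ∈ intVectors d, z ≠ 0 ∧ ∀ i, |(A *ᵥ z) i| < c i := by
  have hdet : LinearMap.det (Matrix.toLin' A) ≠ 0 := by
    rw [LinearMap.det_toLin']
    intro h
    simp [h] at hA
  let b := Pi.basisFun ℝ (Fin d)
  let box : Set (Fin d → ℝ) := Set.pi Set.univ fun i => Set.Ioo (-c i) (c i)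
  let S : Set (Fin d → ℝ) := Matrix.toLin' A ⁻¹' box
  have hmem : ∀ x, x ∈ S ↔ ∀ i, |(A *ᵥ x) i| < c i := fun x => by
    simp [S, box, Set.mem_pi, abs_lt]
  have hvol : volume S = ENNReal.ofReal (∏ i, 2 * c i) := by
    rw [Measure.addHaar_preimage_linearMap volume hdet, LinearMap.det_toLin', abs_inv, hA,
      Real.volume_pi_Ioo, ENNReal.ofReal_prod_of_nonneg fun i _ => by linarith [hc i]]
    simp [two_mul]
  have hfund : volume (ZSpan.fundamentalDomain b) = 1 := by
    rw [ZSpan.fundamentalDomain_pi_basisFun, volume_pi, Measure.pi_pi]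
    simp
  have hconv : Convex ℝ S :=
    (convex_pi fun i _ => convex_Ioo _ _).linear_preimage _
  have hsymm : ∀ x ∈ S, -x ∈ S := fun x hx => by
    rw [hmem] at hx ⊢
    intro i
    rw [Matrix.mulVec_neg, Pi.neg_apply, abs_neg]
    exact hx i
  have hlt : volume (ZSpan.fundamentalDomain b) * 2 ^ finrank ℝ (Fin d → ℝ) < volume S := by
    rw [hfund, hvol, Finset.prod_mul_distrib]
    have h2 : (2 : ENNReal) ^ d = ENNReal.ofReal (2 ^ d) := by
      rw [ENNReal.ofReal_pow (by norm_num)]; simp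
    simp only [finrank_fin_fun, one_mul, Finset.prod_const, Finset.card_univ, Fintype.card_fin]
    rw [h2, ENNReal.ofReal_lt_ofReal_iff (by positivity)]
    exact lt_mul_of_one_lt_right (by positivity) hprod
  have : Countable (Submodule.span ℤ (Set.range b)).toAddSubgroup :=
    inferInstanceAs (Countable (Submodule.span ℤ (Set.range b)))
  obtain ⟨⟨x, hx⟩, hx0, hxS⟩ := exists_ne_zero_mem_lattice_of_measure_mul_two_pow_lt_measure
    (ZSpan.isAddFundamentalDomain' b volume) hsymm hconv hlt
  refine ⟨x, ?_, fun h => hx0 (by simpa using h), (hmem x).1 hxS⟩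
  have hx' : x ∈ Submodule.span ℤ (Set.range b) := hx
  rw [b.mem_span_iff_repr_mem ℤ x] at hx'
  choose z hz using hx'
  exact ⟨z, funext fun i => by simpa [b] using hz i⟩

/-- An orthogonal change of coordinates adapted to the flag spanned by the columns `v`. -/
theorem exists_orthogonal_triangular {d : ℕ} (v : Fin d → Fin d → ℝ) :
    ∃ Q : Matrix (Fin d) (Fin d) ℝ, |Q.det| = 1 ∧ (∀ x, ∑ i, (Q *ᵥ x) i ^ 2 = ∑ i, x i ^ 2) ∧
      ∀ i j, i < j → (Q *ᵥ v i) j = 0 := by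
  let f : Fin d → EuclideanSpace ℝ (Fin d) := fun i => WithLp.toLp 2 (v i)
  let b := InnerProductSpace.gramSchmidtOrthonormalBasis (𝕜 := ℝ)
    (finrank_euclideanSpace_fin (𝕜 := ℝ) (n := d) |>.trans (Fintype.card_fin d).symm) f
  let Q : Matrix (Fin d) (Fin d) ℝ := Matrix.of fun i j => b i j
  have hQ : ∀ x i, (Q *ᵥ x) i = inner ℝ (b i) (WithLp.toLp 2 x) := fun x i => by
    simp [Q, Matrix.mulVec, dotProduct, PiLp.inner_apply, mul_comm]
  have hQQ : Q * Qᵀ = 1 := by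
    ext i j
    have := orthonormal_iff_ite.1 b.orthonormal i j
    rw [Matrix.one_apply, ← this]
    simp [Q, Matrix.mul_apply, PiLp.inner_apply, mul_comm]
  refine ⟨Q, ?_, fun x => ?_, fun i j hij => ?_⟩
  · have h := congrArg Matrix.det hQQ
    rw [Matrix.det_mul, Matrix.det_transpose, Matrix.det_one, ← sq] at h
    rwa [← abs_one, ← sq_eq_sq_iff_abs_eq_abs, one_pow]
  · have h := b.sum_sq_norm_inner_right (WithLp.toLp 2 x)
    simp_rw [hQ]
    rw [EuclideanSpace.norm_sq_eq] at h
    simpa using h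
  · rw [hQ]
    exact InnerProductSpace.gramSchmidtOrthonormalBasis_inv_triangular _ _ hij

/-- A sequence whose `i`-th term (for `i < d`) is a shortest vector of `Λ` outside the span of the
previous ones. -/
def IsGreedy {d : ℕ} (Λ : Set (Fin d → ℝ)) (v : ℕ → Fin d → ℝ) (j : ℕ) : Prop :=
  ∀ i < j, v i ∈ Λ ∧ v i ∉ Submodule.span ℝ (v '' Set.Iio i) ∧
    ∀ x ∈ Λ, x ∉ Submodule.span ℝ (v '' Set.Iio i) → ‖v i‖ ≤ ‖x‖

theorem range_fin_eq_image_Iio {α : Type*} (v : ℕ → α) (j : ℕ) :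
    Set.range (fun i : Fin j => v i) = v '' Set.Iio j := by
  ext x
  constructor
  · rintro ⟨i, rfl⟩
    exact ⟨i, i.2, rfl⟩
  · rintro ⟨i, hi, rfl⟩
    exact ⟨⟨i, hi⟩, rfl⟩

theorem IsGreedy.linearIndependent {d : ℕ} {Λ : Set (Fin d → ℝ)} {v : ℕ → Fin d → ℝ} {j : ℕ}
    (hv : IsGreedy Λ v j) : LinearIndependent ℝ fun i : Fin j => v i := by
  induction j with
  | zero => exact linearIndependent_empty_type
  | succ j ih =>
    rw [linearIndependent_finSucc']
    refine ⟨ih fun i hi => hv i (by omega), ?_⟩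
    have : Fin.init (fun i : Fin (j + 1) => v i) = fun i : Fin j => v i := rfl
    rw [this, range_fin_eq_image_Iio]
    exact (hv j (by omega)).2.1

theorem IsGreedy.norm_le {d : ℕ} {Λ : Set (Fin d → ℝ)} {v : ℕ → Fin d → ℝ} {j : ℕ}
    (hv : IsGreedy Λ v j) {i i' : ℕ} (h : i ≤ i') (hi' : i' < j) : ‖v i‖ ≤ ‖v i'‖ :=
  (hv i (by omega)).2.2 _ (hv i' hi').1 fun hmem => (hv i' hi').2.1 <|
    Submodule.span_mono (Set.image_mono (Set.Iio_subset_Iio h)) hmem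

theorem IsGreedy.norm_pos {d : ℕ} {Λ : Set (Fin d → ℝ)} {v : ℕ → Fin d → ℝ} {j : ℕ}
    (hv : IsGreedy Λ v j) {i : ℕ} (hi : i < j) : 0 < ‖v i‖ :=
  norm_pos_iff.2 fun h => (hv i hi).2.1 (h ▸ Submodule.zero_mem _)

theorem exists_notMem_span_image_Iio {E : Type*} [AddCommGroup E] [Module ℝ E] (v : ℕ → E)
    {i k : ℕ} (hik : i < k) {u : Fin k → E} (hu : LinearIndependent ℝ u) :
    ∃ j, u j ∉ Submodule.span ℝ (v '' Set.Iio i) := by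
  by_contra! h
  have hfin : (v '' Set.Iio i).Finite := (Set.finite_Iio i).image v
  have : FiniteDimensional ℝ (Submodule.span ℝ (v '' Set.Iio i)) :=
    FiniteDimensional.span_of_finite ℝ hfin
  have h1 : finrank ℝ (Submodule.span ℝ (Set.range u)) = k := by
    simpa using finrank_span_eq_card hu
  have h2 : finrank ℝ (Submodule.span ℝ (Set.range u)) ≤
      finrank ℝ (Submodule.span ℝ (v '' Set.Iio i)) :=
    Submodule.finrank_mono (Submodule.span_le.2 (by rintro _ ⟨j, rfl⟩; exact h j))
  have h3 : finrank ℝ (Submodule.span ℝ (v '' Set.Iio i)) ≤ i := by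
    rw [← range_fin_eq_image_Iio]
    exact (finrank_range_le_card (R := ℝ) fun a : Fin i => v a).trans_eq (Fintype.card_fin i)
  omega

theorem IsGreedy.succMin_eq {d : ℕ} {Λ : Set (Fin d → ℝ)} {v : ℕ → Fin d → ℝ}
    (hv : IsGreedy Λ v d) {i : ℕ} (hi : i < d) : succMin d Λ (i + 1) = ‖v i‖ := by
  refine IsLeast.csInf_eq ⟨⟨hv.norm_pos hi, fun j => v j, fun j => (hv j (by omega)).1, ?_,
    fun j => hv.norm_le (by omega) hi⟩, ?_⟩
  · exact IsGreedy.linearIndependent (Λ := Λ) (j := i + 1) fun l hl => hv l (by omega)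
  · rintro r ⟨-, u, huΛ, hu, hur⟩
    obtain ⟨j, hj⟩ := exists_notMem_span_image_Iio v (Nat.lt_succ_self i) hu
    exact ((hv i hi).2.2 _ (huΛ j) hj).trans (hur j)

theorem finite_latticeOf_inter_norm_le {d : ℕ} {h : Matrix (Fin d) (Fin d) ℝ} (hh : h.det = 1)
    (R : ℝ) : {x ∈ latticeOf h | ‖x‖ ≤ R}.Finite := by
  have hfin : {z : Fin d → ℤ | ‖fun i => (z i : ℝ)‖ ≤
      ‖LinearMap.toContinuousLinearMap (Matrix.toLin' h⁻¹)‖ * R}.Finite := by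
    generalize ‖LinearMap.toContinuousLinearMap (Matrix.toLin' h⁻¹)‖ * R = C
    refine (Set.finite_Icc (fun _ : Fin d => -⌈C⌉) fun _ => ⌈C⌉).subset fun z hz => ?_
    have hz' : ∀ i, |(z i : ℝ)| ≤ C := fun i => (norm_le_pi_norm (fun i => (z i : ℝ)) i).trans hz
    refine ⟨fun i => ?_, fun i => ?_⟩
    · have := (abs_le.1 (hz' i)).1
      have hc := Int.le_ceil C
      have : ((-⌈C⌉ : ℤ) : ℝ) ≤ z i := by push_cast; linarith
      exact_mod_cast this
    · have := (abs_le.1 (hz' i)).2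
      have hc := Int.le_ceil C
      have : ((z i : ℤ) : ℝ) ≤ ⌈C⌉ := by linarith
      exact_mod_cast this
  refine (hfin.image fun z => h *ᵥ fun i => (z i : ℝ)).subset ?_
  rintro _ ⟨⟨_, ⟨z, rfl⟩, rfl⟩, hx⟩
  refine ⟨z, ?_, rfl⟩
  have hz : (fun i => (z i : ℝ)) = Matrix.toLin' h⁻¹ (h *ᵥ fun i => (z i : ℝ)) := by
    rw [Matrix.toLin'_apply, Matrix.mulVec_mulVec, Matrix.nonsing_inv_mul _ (by simp [hh]),
      Matrix.one_mulVec]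
  rw [Set.mem_ofPred_eq, hz]
  exact (ContinuousLinearMap.le_opNorm (LinearMap.toContinuousLinearMap (Matrix.toLin' h⁻¹))
    _).trans (mul_le_mul_of_nonneg_left hx (norm_nonneg _))

theorem exists_minimal_notMem {d : ℕ} {h : Matrix (Fin d) (Fin d) ℝ} (hh : h.det = 1)
    (V : Submodule ℝ (Fin d → ℝ)) (hV : ∃ x ∈ latticeOf h, x ∉ V) :
    ∃ x ∈ latticeOf h, x ∉ V ∧ ∀ y ∈ latticeOf h, y ∉ V → ‖x‖ ≤ ‖y‖ := by
  obtain ⟨x₀, hx₀, hx₀V⟩ := hV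
  have hfin : {x ∈ latticeOf h | x ∉ V ∧ ‖x‖ ≤ ‖x₀‖}.Finite :=
    (finite_latticeOf_inter_norm_le hh ‖x₀‖).subset fun x hx => ⟨hx.1, hx.2.2⟩
  obtain ⟨x, ⟨hx, hxV, hxle⟩, hmin⟩ :=
    Set.exists_min_image _ (fun x => ‖x‖) hfin ⟨x₀, hx₀, hx₀V, le_rfl⟩
  refine ⟨x, hx, hxV, fun y hy hyV => ?_⟩
  by_cases hle : ‖y‖ ≤ ‖x₀‖
  · exact hmin y ⟨hy, hyV, hle⟩
  · exact hxle.trans (not_le.1 hle).le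

theorem linearIndependent_transpose_of_det_eq_one {d : ℕ} {h : Matrix (Fin d) (Fin d) ℝ}
    (hh : h.det = 1) : LinearIndependent ℝ hᵀ :=
  Matrix.linearIndependent_cols_of_isUnit
    ((Matrix.isUnit_iff_isUnit_det _).2 (hh ▸ isUnit_one))

theorem transpose_mem_latticeOf {d : ℕ} (h : Matrix (Fin d) (Fin d) ℝ) (j : Fin d) :
    hᵀ j ∈ latticeOf h := by
  refine ⟨_, ⟨Pi.single j 1, rfl⟩, ?_⟩
  ext i
  simp [Matrix.mulVec, dotProduct, Pi.single_apply]

theorem exists_isGreedy {d : ℕ} {h : Matrix (Fin d) (Fin d) ℝ} (hh : h.det = 1) :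
    ∃ v, IsGreedy (latticeOf h) v d := by
  suffices ∀ j ≤ d, ∃ v, IsGreedy (latticeOf h) v j from this d le_rfl
  intro j
  induction j with
  | zero => exact fun _ => ⟨fun _ => 0, fun i hi => by omega⟩
  | succ j ih =>
    intro hj
    obtain ⟨v, hv⟩ := ih (by omega)
    obtain ⟨c, hc⟩ := exists_notMem_span_image_Iio v hj
      (linearIndependent_transpose_of_det_eq_one hh)
    obtain ⟨x, hx, hxV, hmin⟩ := exists_minimal_notMem hh _ ⟨_, transpose_mem_latticeOf h c, hc⟩
    have himg : ∀ i ≤ j, Function.update v j x '' Set.Iio i = v '' Set.Iio i := fun i hi =>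
      Set.image_congr fun a ha => Function.update_of_ne (by simp at ha; omega) _ _
    refine ⟨Function.update v j x, fun i hi => ?_⟩
    rw [himg i (by omega)]
    rcases Nat.lt_succ_iff_lt_or_eq.1 hi with hlt | rfl
    · rw [Function.update_of_ne hlt.ne]
      exact hv i hlt
    · rw [Function.update_self]
      exact ⟨hx, hxV, hmin⟩

/-- The upper bound in Minkowski's second theorem, for greedy vectors. -/
theorem IsGreedy.prod_norm_le {d : ℕ} {h : Matrix (Fin d) (Fin d) ℝ} (hh : h.det = 1)
    {v : ℕ → Fin d → ℝ} (hv : IsGreedy (latticeOf h) v d) :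
    ∏ i : Fin d, ‖v i‖ ≤ (d : ℝ) ^ d := by
  by_contra! hlt
  have hd : d ≠ 0 := by
    rintro rfl
    simp at hlt
  have hd0 : (0 : ℝ) < d := by positivity
  obtain ⟨Q, hQdet, hQnorm, hQtri⟩ := exists_orthogonal_triangular fun i : Fin d => v i
  obtain ⟨z, hz, hz0, hzlt⟩ := exists_int_mulVec_abs_lt (Q * h)
    (by rw [Matrix.det_mul, hh, mul_one, hQdet]) (fun i => ‖v i‖ / d)
    (fun i => div_pos (hv.norm_pos i.2) hd0) (by
      rw [Finset.prod_div_distrib, Finset.prod_const, Finset.card_univ, Fintype.card_fin,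
        one_lt_div (by positivity)]
      exact hlt)
  have hx0 : h *ᵥ z ≠ 0 := fun h0 => hz0 <|
    Matrix.eq_zero_of_mulVec_eq_zero (by simp [hh]) h0
  have hxΛ : h *ᵥ z ∈ latticeOf h := ⟨z, hz, rfl⟩
  simp_rw [← Matrix.mulVec_mulVec] at hzlt
  generalize h *ᵥ z = x at hx0 hxΛ hzlt
  have htop : x ∈ Submodule.span ℝ (v '' Set.Iio d) := by
    rw [← range_fin_eq_image_Iio, hv.linearIndependent.span_eq_top_of_card_eq_finrank' (by simp)]
    trivial
  have hex : ∃ j, x ∈ Submodule.span ℝ (v '' Set.Iio j) := ⟨d, htop⟩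
  let j := Nat.find hex
  have hjd : j ≤ d := Nat.find_min' hex htop
  have hj : x ∈ Submodule.span ℝ (v '' Set.Iio j) := Nat.find_spec hex
  have hjpos : 0 < j := by
    by_contra h0
    have h0 : j = 0 := by omega
    rw [h0] at hj
    simp at hj
    exact hx0 hj
  obtain ⟨l, hl⟩ : ∃ l, j = l + 1 := ⟨j - 1, by omega⟩
  have hnot : x ∉ Submodule.span ℝ (v '' Set.Iio l) := Nat.find_min hex (by omega)
  have hle : ‖v l‖ ≤ ‖x‖ := (hv l (by omega)).2.2 x hxΛ hnot
  have hzero : ∀ i : Fin d, l < i → (Q *ᵥ x) i = 0 := fun i hi => by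
    have : Submodule.span ℝ (v '' Set.Iio j) ≤
        LinearMap.ker (LinearMap.proj i ∘ₗ Matrix.toLin' Q) := by
      rw [Submodule.span_le]
      rintro _ ⟨a, ha, rfl⟩
      have ha' : a < j := ha
      exact hQtri ⟨a, by omega⟩ i (by rw [Fin.lt_def]; simp only; omega)
    exact this hj
  have hbd : ∀ i : Fin d, (Q *ᵥ x) i ^ 2 ≤ (‖v l‖ / d) ^ 2 := fun i => by
    rw [sq_le_sq, abs_of_nonneg (a := ‖v l‖ / d) (by positivity)]
    rcases le_or_gt (i : ℕ) l with hi | hi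
    · refine (hzlt i).le.trans ?_
      gcongr
      exact hv.norm_le hi (by omega)
    · rw [hzero i hi, abs_zero]
      positivity
  refine hle.not_gt ((pi_norm_lt_iff (hv.norm_pos (by omega))).2 fun a => ?_)
  refine abs_lt_of_sq_lt_sq ?_ (norm_nonneg _)
  calc x a ^ 2 ≤ ∑ i, x i ^ 2 := Finset.single_le_sum (f := fun i => x i ^ 2)
        (fun i _ => sq_nonneg _) (Finset.mem_univ a)
    _ = ∑ i, (Q *ᵥ x) i ^ 2 := (hQnorm x).symm
    _ < ∑ _i : Fin d, (‖v l‖ / d) ^ 2 := by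
        refine Finset.sum_lt_sum (fun i _ => hbd i) ⟨⟨l, by omega⟩, Finset.mem_univ _, ?_⟩
        rw [sq_lt_sq, abs_of_nonneg (a := ‖v l‖ / d) (by positivity)]
        exact hzlt ⟨l, by omega⟩
    _ = ‖v l‖ ^ 2 / d := by
        rw [Finset.sum_const, Finset.card_univ, Fintype.card_fin, nsmul_eq_mul]
        field_simp
    _ ≤ ‖v l‖ ^ 2 := div_le_self (sq_nonneg _) (by exact_mod_cast Nat.one_le_iff_ne_zero.2 hd)

/-- Coordinates of lattice vectors with respect to linearly independent lattice vectors have a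
common denominator. -/
theorem exists_common_denominator {d : ℕ} {g : Matrix (Fin d) (Fin d) ℝ} (hg : g.det = 1)
    {w : Fin d → Fin d → ℝ} (hw : ∀ i, w i ∈ latticeOf g) (hli : LinearIndependent ℝ w) :
    ∃ N : ℤ, N ≠ 0 ∧ ∀ c : Fin d → ℝ, ∑ i, c i • w i ∈ latticeOf g → ∀ i, ∃ a : ℤ, N * c i = a := by
  choose y hy hyw using hw
  choose z hz using hy
  let Y : Matrix (Fin d) (Fin d) ℤ := Matrix.of fun i j => z j i
  let Yr : Matrix (Fin d) (Fin d) ℝ := Y.map (Int.castRingHom ℝ)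
  have hdetY : Yr.det = (Y.det : ℝ) := 
    ((Int.castRingHom ℝ).map_det Y).symm
  have hsum : ∀ c, ∑ i, c i • w i = g *ᵥ (Yr *ᵥ c) := fun c => by
    have h1 : Yr *ᵥ c = ∑ i, c i • y i := by
      ext a
      simp [Yr, Y, Matrix.mulVec, dotProduct, ← hz, Finset.sum_apply, mul_comm]
    rw [h1, Matrix.mulVec_sum]
    simp_rw [Matrix.mulVec_smul, hyw]
  have hunit : IsUnit g.det := by rw [hg]; exact isUnit_one
  refine ⟨Y.det, fun h0 => ?_, fun c hc i => ?_⟩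
  · obtain ⟨c, hc0, hc⟩ := Matrix.exists_mulVec_eq_zero_iff.2 (show Yr.det = 0 by simp [hdetY, h0])
    have := Fintype.linearIndependent_iff.1 hli c (by rw [hsum, hc, Matrix.mulVec_zero])
    exact hc0 (funext this)
  · obtain ⟨_, ⟨x, rfl⟩, hx⟩ := hc
    rw [hsum] at hx
    have hx' := Matrix.mulVec_injective_of_isUnit ((Matrix.isUnit_iff_isUnit_det _).2 hunit) hx
    refine ⟨(Y.adjugate *ᵥ x) i, ?_⟩
    replace hx' : (fun i => (x i : ℝ)) = Yr *ᵥ c := hx'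
    have h2 : Yr.det • c = Yr.adjugate *ᵥ fun i => (x i : ℝ) := by
      rw [hx', Matrix.mulVec_mulVec, Matrix.adjugate_mul, Matrix.smul_mulVec, Matrix.one_mulVec]
    have h3 := congrFun h2 i
    rw [Pi.smul_apply, smul_eq_mul, hdetY] at h3
    rw [h3]
    have h4 : Yr.adjugate = Y.adjugate.map (Int.castRingHom ℝ) :=
      ((Int.castRingHom ℝ).map_adjugate Y).symm
    simp [h4, Matrix.mulVec, dotProduct]

theorem gramCoeff_sum_smul {d k : ℕ} (q : Matrix (Fin k) (Fin k) ℝ) (w : Fin k → Fin d → ℝ)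
    (I : Finset (Fin d)) : gramCoeff (fun j => ∑ l, q j l • w l) I = q.det * gramCoeff w I := by
  unfold gramCoeff
  split_ifs with h
  · rw [← Matrix.det_transpose q, mul_comm, ← Matrix.det_mul]
    congr 1
    ext r c
    simp [Matrix.mul_apply, Finset.sum_apply, mul_comm]
  · rw [mul_zero]

theorem abs_gramCoeff_le {d k : ℕ} (v : Fin k → Fin d → ℝ) (I : Finset (Fin d)) :
    |gramCoeff v I| ≤ k.factorial * ∏ j, ‖v j‖ := by
  unfold gramCoeff
  split_ifs with h
  · rw [Matrix.det_apply]
    refine (Finset.abs_sum_le_sum_abs _ _).trans ?_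
    have : ∀ σ : Equiv.Perm (Fin k), |Equiv.Perm.sign σ • ∏ i, Matrix.of (fun r c : Fin k =>
        v c (I.orderEmbOfFin h r)) (σ i) i| ≤ ∏ j, ‖v j‖ := fun σ => by
      rw [Units.smul_def, zsmul_eq_mul, abs_mul, ← Int.cast_abs,
        Int.isUnit_iff_abs_eq.1 (Units.isUnit _), Int.cast_one, one_mul, Finset.abs_prod]
      simp only [Matrix.of_apply]
      exact Finset.prod_le_prod (fun _ _ => abs_nonneg _) fun i _ => norm_le_pi_norm (v i) _
    refine (Finset.sum_le_sum fun σ _ => this σ).trans ?_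
    simp [Fintype.card_perm]
  · rw [abs_zero]
    positivity

theorem aMat_mulVec_apply (m : ℕ) {d : ℕ} (ω : Fin d → ℝ) (t : ℝ) (x : Fin d → ℝ) (i : Fin d) :
    (aMat m ω t *ᵥ x) i = Real.exp (signedWeight m ω i * t) * x i := by
  rw [aMat, Matrix.mulVec_diagonal]

theorem aMat_mulVec_aMat_mulVec (m : ℕ) {d : ℕ} (ω : Fin d → ℝ) (s t : ℝ) (x : Fin d → ℝ) :
    aMat m ω s *ᵥ (aMat m ω t *ᵥ x) = aMat m ω (s + t) *ᵥ x := by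
  ext i
  simp only [aMat_mulVec_apply]
  rw [← mul_assoc, ← Real.exp_add, mul_add]

theorem aMat_zero_mulVec (m : ℕ) {d : ℕ} (ω : Fin d → ℝ) (x : Fin d → ℝ) :
    aMat m ω 0 *ᵥ x = x := by
  ext i
  simp [aMat_mulVec_apply]

theorem aMat_neg_mulVec_aMat_mulVec (m : ℕ) {d : ℕ} (ω : Fin d → ℝ) (t : ℝ) (x : Fin d → ℝ) :
    aMat m ω (-t) *ᵥ (aMat m ω t *ᵥ x) = x := by
  rw [aMat_mulVec_aMat_mulVec, neg_add_cancel, aMat_zero_mulVec]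

theorem aMat_mulVec_aMat_neg_mulVec (m : ℕ) {d : ℕ} (ω : Fin d → ℝ) (t : ℝ) (x : Fin d → ℝ) :
    aMat m ω t *ᵥ (aMat m ω (-t) *ᵥ x) = x := by
  rw [aMat_mulVec_aMat_mulVec, add_neg_cancel, aMat_zero_mulVec]

theorem gramCoeff_aMat_mulVec (m : ℕ) {d k : ℕ} (ω : Fin d → ℝ) (t : ℝ) (u : Fin k → Fin d → ℝ)
    (I : Finset (Fin d)) :
    gramCoeff (fun j => aMat m ω t *ᵥ u j) I = Real.exp (muI m ω I * t) * gramCoeff u I := by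
  unfold gramCoeff
  split_ifs with h
  · have hexp : Real.exp (muI m ω I * t) =
        ∏ r : Fin k, Real.exp (signedWeight m ω (I.orderEmbOfFin h r) * t) := by
      rw [← Real.exp_sum, ← Finset.sum_mul, muI]
      conv_lhs => rw [← Finset.map_orderEmbOfFin_univ I h, Finset.sum_map]
      rfl
    rw [hexp, ← Matrix.det_mul_column]
    congr 1
    ext r c
    simp [aMat_mulVec_apply]
  · rw [mul_zero]

theorem norm_aMat_mulVec_le (m : ℕ) {d : ℕ} (ω : Fin d → ℝ) (s t : ℝ) (x : Fin d → ℝ) :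
    ‖aMat m ω t *ᵥ x‖ ≤
      Real.exp ((∑ i, |signedWeight m ω i|) * |t - s|) * ‖aMat m ω s *ᵥ x‖ := by
  refine (pi_norm_le_iff_of_nonneg (by positivity)).2 fun i => ?_
  have h : aMat m ω t *ᵥ x = aMat m ω (t - s) *ᵥ (aMat m ω s *ᵥ x) := by
    rw [aMat_mulVec_aMat_mulVec, sub_add_cancel]
  rw [h, aMat_mulVec_apply, norm_mul, Real.norm_eq_abs, Real.abs_exp]
  refine mul_le_mul (Real.exp_le_exp.2 ?_) (norm_le_pi_norm _ i) (norm_nonneg _)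
    (Real.exp_pos _).le
  refine (le_abs_self _).trans ?_
  rw [abs_mul]
  gcongr
  exact Finset.single_le_sum (f := fun i => |signedWeight m ω i|) (fun _ _ => abs_nonneg _)
    (Finset.mem_univ i)

theorem IsWeightVector.det_aMat {m n : ℕ} {ω : Fin (m + n) → ℝ} (hω : IsWeightVector m n ω)
    (t : ℝ) : (aMat m ω t).det = 1 := by
  obtain ⟨-, -, -, h1, h2⟩ := hω
  rw [aMat, Matrix.det_diagonal, ← Real.exp_sum, ← Finset.sum_mul]
  have : ∑ i, signedWeight m ω i = 0 := by
    simp_rw [← not_lt] at h2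
    unfold signedWeight
    rw [Finset.sum_ite, Finset.sum_neg_distrib, h1, h2, add_neg_cancel]
  rw [this, zero_mul, Real.exp_zero]

theorem aMat_mulVec_image_latticeOf (m : ℕ) {d : ℕ} (ω : Fin d → ℝ) (t : ℝ)
    (g : Matrix (Fin d) (Fin d) ℝ) :
    (aMat m ω t).mulVec '' latticeOf g = latticeOf (aMat m ω t * g) := by
  simp [latticeOf, Set.image_image]

/-- Minors of `k` independent lattice vectors in a fixed subspace are bounded below. -/
theorem exists_le_abs_gramCoeff {d k : ℕ} (hkd : k ≤ d) {g : Matrix (Fin d) (Fin d) ℝ}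
    (hg : g.det = 1) {w : ℕ → Fin d → ℝ} (hw : ∀ i < d, w i ∈ latticeOf g)
    (hli : LinearIndependent ℝ fun i : Fin d => w i) :
    ∃ c > 0, ∀ u : Fin k → Fin d → ℝ, (∀ j, u j ∈ latticeOf g) → LinearIndependent ℝ u →
      (∀ j, u j ∈ Submodule.span ℝ (w '' Set.Iio k)) →
      ∀ I, c * |gramCoeff (fun j : Fin k => w j) I| ≤ |gramCoeff u I| := by
  obtain ⟨N, hN, hint⟩ := exists_common_denominator hg (fun i : Fin d => hw i i.2) hli
  have hN' : (0 : ℝ) < |(N : ℝ)| := by positivity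
  refine ⟨(|(N : ℝ)| ^ k)⁻¹, by positivity, fun u huΛ hu hspan I => ?_⟩
  simp_rw [← range_fin_eq_image_Iio, Submodule.mem_span_range_iff_exists_fun] at hspan
  choose q hq using hspan
  have hqint : ∀ j l, ∃ a : ℤ, N * q j l = a := fun j l => by
    let c : ℕ → ℝ := fun i => if h : i < k then q j ⟨i, h⟩ else 0
    have hsum : ∑ i : Fin d, c i • w i = u j := by
      rw [← hq j, Fin.sum_univ_eq_sum_range (fun i => c i • w i) d,
        ← Finset.sum_subset (Finset.range_mono hkd), ← Fin.sum_univ_eq_sum_range]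
      · simp [c]
      · intro i _ hi
        have : ¬ i < k := by simpa using hi
        simp [c, this]
    obtain ⟨a, ha⟩ := hint (fun i => c i) (by rw [hsum]; exact huΛ j) ⟨l, by omega⟩
    exact ⟨a, by simpa [c] using ha⟩
  choose a ha using hqint
  let Q : Matrix (Fin k) (Fin k) ℝ := Matrix.of q
  have hu' : u = fun j => ∑ l, Q j l • w l := funext fun j => (hq j).symm
  have hQ : Q.det ≠ 0 := by
    intro h0
    obtain ⟨c, hc0, hc⟩ := Matrix.exists_vecMul_eq_zero_iff.2 h0
    refine hc0 (funext (Fintype.linearIndependent_iff.1 hu c ?_))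
    rw [hu']
    simp_rw [Finset.smul_sum, smul_smul]
    rw [Finset.sum_comm]
    refine Finset.sum_eq_zero fun l _ => ?_
    rw [← Finset.sum_smul]
    have := congrFun hc l
    simp only [Matrix.vecMul, dotProduct, Pi.zero_apply] at this
    rw [this, zero_smul]
  have hdet : (N : ℝ) ^ k * Q.det = ((Matrix.of a).det : ℤ) := by
    have h1 : (N : ℝ) • Q = (Matrix.of a).map (Int.castRingHom ℝ) := by
      ext j l
      simpa [Q] using ha j l
    have h2 := congrArg Matrix.det h1
    rw [Matrix.det_smul, Fintype.card_fin] at h2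
    rw [h2]
    simpa using ((Int.castRingHom ℝ).map_det (Matrix.of a)).symm
  have hge : 1 ≤ |(N : ℝ)| ^ k * |Q.det| := by
    rw [← abs_pow, ← abs_mul, hdet]
    have : (Matrix.of a).det ≠ 0 := fun h0 => by
      rw [h0, Int.cast_zero] at hdet
      exact mul_ne_zero (pow_ne_zero k (by exact_mod_cast hN)) hQ hdet
    exact_mod_cast Int.one_le_abs this
  rw [hu', gramCoeff_sum_smul, abs_mul]
  refine mul_le_mul_of_nonneg_right ?_ (abs_nonneg _)
  rwa [inv_le_iff_one_le_mul₀' (by positivity)]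

/-- The subspace `W` is spanned by `k` lattice vectors which are shorter at time `t` than every
lattice vector outside `W`. -/
def HasGapAt (m : ℕ) {d : ℕ} (ω : Fin d → ℝ) (g : Matrix (Fin d) (Fin d) ℝ) (k : ℕ) (t : ℝ)
    (W : Submodule ℝ (Fin d → ℝ)) : Prop :=
  ∃ (r r' : ℝ) (u : ℕ → Fin d → ℝ), r < r' ∧ (∀ j < d, u j ∈ latticeOf g) ∧
    LinearIndependent ℝ (fun i : Fin d => u i) ∧ Submodule.span ℝ (u '' Set.Iio k) = W ∧
    (∀ j < k, ‖aMat m ω t *ᵥ u j‖ ≤ r) ∧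
    ∀ x ∈ latticeOf g, x ∉ W → r' ≤ ‖aMat m ω t *ᵥ x‖

theorem finrank_span_image_Iio {d k : ℕ} (hkd : k ≤ d) {u : ℕ → Fin d → ℝ}
    (hu : LinearIndependent ℝ fun i : Fin d => u i) :
    finrank ℝ (Submodule.span ℝ (u '' Set.Iio k)) = k := by
  rw [← range_fin_eq_image_Iio]
  exact (finrank_span_eq_card (hu.comp (Fin.castLE hkd) (Fin.castLE_injective hkd))).trans
    (Fintype.card_fin k)

theorem span_image_Iio_le_of_norm_lt {d k : ℕ} {Λ : Set (Fin d → ℝ)} {f : (Fin d → ℝ) → ℝ}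
    {W : Submodule ℝ (Fin d → ℝ)} {R R' : ℝ} (hR : R < R') {u : ℕ → Fin d → ℝ}
    (hu : ∀ j < k, u j ∈ Λ) (hle : ∀ j < k, f (u j) ≤ R) (hW : ∀ x ∈ Λ, x ∉ W → R' ≤ f x) :
    Submodule.span ℝ (u '' Set.Iio k) ≤ W := by
  rw [Submodule.span_le]
  rintro _ ⟨j, hj, rfl⟩
  by_contra hmem
  exact absurd (hle j hj) (not_le.2 (hR.trans_le (hW _ (hu j hj) hmem)))

theorem HasGapAt.unique {m d k : ℕ} (hkd : k ≤ d) {ω : Fin d → ℝ} {g : Matrix (Fin d) (Fin d) ℝ}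
    {t : ℝ} {W W' : Submodule ℝ (Fin d → ℝ)} (h : HasGapAt m ω g k t W)
    (h' : HasGapAt m ω g k t W') : W = W' := by
  obtain ⟨r, s, u, hrs, hu, hli, hspan, hle, hW⟩ := h
  obtain ⟨r', s', u', hrs', hu', hli', hspan', hle', hW'⟩ := h'
  have hr : finrank ℝ W = finrank ℝ W' := by
    rw [← hspan, ← hspan', finrank_span_image_Iio hkd hli, finrank_span_image_Iio hkd hli']
  rcases le_total r r' with hc | hc
  · refine Submodule.eq_of_le_of_finrank_eq ?_ hr
    rw [← hspan]
    exact span_image_Iio_le_of_norm_lt (f := fun x => ‖aMat m ω t *ᵥ x‖) (hc.trans_lt hrs')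
      (fun j hj => hu j (by omega)) hle hW'
  · refine (Submodule.eq_of_le_of_finrank_eq ?_ hr.symm).symm
    rw [← hspan']
    exact span_image_Iio_le_of_norm_lt (f := fun x => ‖aMat m ω t *ᵥ x‖) (hc.trans_lt hrs)
      (fun j hj => hu' j (by omega)) hle' hW

theorem HasGapAt.eventually {m d k : ℕ} {ω : Fin d → ℝ} {g : Matrix (Fin d) (Fin d) ℝ}
    {s : ℝ} {W : Submodule ℝ (Fin d → ℝ)} (h : HasGapAt m ω g k s W) :
    ∀ᶠ t in nhds s, HasGapAt m ω g k t W := by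
  obtain ⟨r, r', u, hrr', hu, hli, hspan, hle, hW⟩ := h
  let M := ∑ i, |signedWeight m ω i|
  have hc1 : Continuous fun t : ℝ => Real.exp (M * |t - s|) * r := by fun_prop
  have hc2 : Continuous fun t : ℝ => (Real.exp (M * |t - s|))⁻¹ * r' := by
    simp_rw [← Real.exp_neg]
    fun_prop
  have hlt : ∀ᶠ t in nhds s,
      Real.exp (M * |t - s|) * r < (Real.exp (M * |t - s|))⁻¹ * r' :=
    hc1.continuousAt.eventually_lt hc2.continuousAt (by simpa using hrr')
  filter_upwards [hlt] with t ht
  refine ⟨_, _, u, ht, hu, hli, hspan, fun j hj => ?_, fun x hx hxW => ?_⟩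
  · exact (norm_aMat_mulVec_le m ω s t _).trans
      (mul_le_mul_of_nonneg_left (hle j hj) (Real.exp_pos _).le)
  · rw [inv_mul_le_iff₀ (Real.exp_pos _), abs_sub_comm]
    exact (hW x hx hxW).trans (norm_aMat_mulVec_le m ω t s x)

theorem aMat_mulVec_mem_latticeOf_mul {m d : ℕ} {ω : Fin d → ℝ} {g : Matrix (Fin d) (Fin d) ℝ}
    {t : ℝ} {x : Fin d → ℝ} (hx : x ∈ latticeOf g) :
    aMat m ω t *ᵥ x ∈ latticeOf (aMat m ω t * g) :=
  aMat_mulVec_image_latticeOf m ω t g ▸ ⟨x, hx, rfl⟩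

theorem aMat_neg_mulVec_mem_latticeOf {m d : ℕ} {ω : Fin d → ℝ} {g : Matrix (Fin d) (Fin d) ℝ}
    {t : ℝ} {x : Fin d → ℝ} (hx : x ∈ latticeOf (aMat m ω t * g)) :
    aMat m ω (-t) *ᵥ x ∈ latticeOf g := by
  rw [← aMat_mulVec_image_latticeOf] at hx
  obtain ⟨y, hy, rfl⟩ := hx
  rwa [aMat_neg_mulVec_aMat_mulVec]

theorem linearIndependent_aMat_mulVec {m d : ℕ} {ω : Fin d → ℝ} (t : ℝ) {ι : Type*}
    {v : ι → Fin d → ℝ} (hv : LinearIndependent ℝ v) :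
    LinearIndependent ℝ fun i => aMat m ω t *ᵥ v i :=
  hv.map' (Matrix.toLin' (aMat m ω t)) <| LinearMap.ker_eq_bot.2 <|
    Function.LeftInverse.injective (f := fun x => aMat m ω t *ᵥ x)
      (g := fun x => aMat m ω (-t) *ᵥ x) (aMat_neg_mulVec_aMat_mulVec m ω t)

theorem IsGreedy.hasGapAt {m d k : ℕ} (hk : 1 ≤ k) (hkd : k < d) {ω : Fin d → ℝ}
    {g : Matrix (Fin d) (Fin d) ℝ} {t : ℝ} {v : ℕ → Fin d → ℝ}
    (hv : IsGreedy (latticeOf (aMat m ω t * g)) v d) (hlt : ‖v (k - 1)‖ < ‖v k‖) :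
    ∃ W, HasGapAt m ω g k t W := by
  refine ⟨_, _, _, fun j => aMat m ω (-t) *ᵥ v j, hlt,
    fun j hj => aMat_neg_mulVec_mem_latticeOf (hv j hj).1,
    linearIndependent_aMat_mulVec (-t) hv.linearIndependent, rfl, fun j hj => ?_,
    fun x hx hxW => ?_⟩
  · rw [aMat_mulVec_aMat_neg_mulVec]
    exact hv.norm_le (by omega) (by omega)
  · refine (hv k hkd).2.2 _ (aMat_mulVec_mem_latticeOf_mul hx) fun hmem => hxW ?_
    have := Submodule.mem_map_of_mem (f := Matrix.toLin' (aMat m ω (-t))) hmem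
    rw [Submodule.map_span, Set.image_image, Matrix.toLin'_apply,
      aMat_neg_mulVec_aMat_mulVec] at this
    exact this

theorem HasGapAt.aMat_neg_mulVec_mem {m d k : ℕ} (hkd : k ≤ d) {ω : Fin d → ℝ}
    {g : Matrix (Fin d) (Fin d) ℝ} {t : ℝ} {W : Submodule ℝ (Fin d → ℝ)}
    (h : HasGapAt m ω g k t W) {v : ℕ → Fin d → ℝ}
    (hv : IsGreedy (latticeOf (aMat m ω t * g)) v d) {i : ℕ} (hi : i < k) :
    aMat m ω (-t) *ᵥ v i ∈ W := by
  obtain ⟨r, r', u, hrr', hu, hli, hspan, hle, hW⟩ := h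
  by_contra hmem
  have h1 := hW _ (aMat_neg_mulVec_mem_latticeOf (hv i (by omega)).1) hmem
  rw [aMat_mulVec_aMat_neg_mulVec] at h1
  obtain ⟨j, hj⟩ := exists_notMem_span_image_Iio v hi (linearIndependent_aMat_mulVec (m := m)
    (ω := ω) t (hli.comp (Fin.castLE hkd) (Fin.castLE_injective hkd)))
  have h2 := (hv i (by omega)).2.2 _ (aMat_mulVec_mem_latticeOf_mul (hu j (by omega))) hj
  have h3 := hle j j.2
  linarith

theorem exists_forall_hasGapAt {m d k : ℕ} (hkd : k ≤ d) {ω : Fin d → ℝ}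
    {g : Matrix (Fin d) (Fin d) ℝ} {T : ℝ} (h : ∀ t ≥ T, ∃ W, HasGapAt m ω g k t W) :
    ∃ W, ∀ t ≥ T, HasGapAt m ω g k t W := by
  choose W hW using fun t : ℝ => h (max t T) (le_max_right t T)
  have hconst : IsLocallyConstant W := by
    rw [IsLocallyConstant.iff_eventually_eq]
    intro s
    have hcont : ContinuousAt (fun t : ℝ => max t T) s := by fun_prop
    filter_upwards [hcont.eventually (hW s).eventually] with t ht
    exact (hW t).unique hkd ht
  refine ⟨W T, fun t ht => ?_⟩
  have := hW t
  rwa [max_eq_left ht, hconst.apply_eq_of_preconnectedSpace t T] at this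

theorem prod_range_le_prod_range_of_one_lt {a : ℕ → ℝ} {k d : ℕ} (hkd : k ≤ d)
    (hpos : ∀ i < d, 0 ≤ a i) (hmono : ∀ i j, i ≤ j → j < d → a i ≤ a j)
    (hlt : 1 < ∏ i ∈ Finset.range k, a i) :
    ∏ i ∈ Finset.range k, a i ≤ ∏ i ∈ Finset.range d, a i := by
  rw [← Finset.prod_range_mul_prod_Ico a hkd]
  refine le_mul_of_one_le_right (by linarith) ?_
  refine Finset.one_le_prod fun i hi => ?_
  rw [Finset.mem_Ico] at hi
  by_contra! h1
  refine hlt.not_ge (Finset.prod_le_one (fun j hj => ?_) fun j hj => ?_)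
  · exact hpos j (by rw [Finset.mem_range] at hj; omega)
  · exact (hmono j i (by rw [Finset.mem_range] at hj; omega) hi.2).trans h1.le

theorem algebraic_connectedness
    (m n : ℕ) (hm : 0 < m) (hn : 0 < n) (hd : 2 ≤ m + n)
    (ω : Fin (m + n) → ℝ) (hω : IsWeightVector m n ω)
    (k : ℕ) (hk1 : 1 ≤ k) (hk2 : k ≤ m + n - 1)
    (g : Matrix (Fin (m + n)) (Fin (m + n)) ℝ) (hg : g.det = 1)
    (H : ∀ (W : Submodule ℝ (Fin (m + n) → ℝ)) (w : Fin k → (Fin (m + n) → ℝ)),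
      (∀ j, w j ∈ latticeOf g) → Submodule.span ℝ (Set.range w) = W →
      Module.finrank ℝ W = k →
      1 < largestEigAlong m ω w) :
    ConnectedAt m ω (latticeOf g) k := by
  by_contra hcon
  unfold ConnectedAt at hcon
  push Not at hcon
  obtain ⟨T, hT⟩ := hcon
  have hkd : k < m + n := by omega
  have hdet : ∀ t, (aMat m ω t * g).det = 1 := fun t => by
    rw [Matrix.det_mul, hω.det_aMat, hg, one_mul]
  choose v hv using fun t => exists_isGreedy (hdet t)
  have hgap : ∀ t ≥ max T 0, ∃ W, HasGapAt m ω g k t W := fun t ht => by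
    refine (hv t).hasGapAt hk1 hkd (lt_of_le_of_ne ((hv t).norm_le (by omega) hkd) fun heq => ?_)
    refine hT t ((le_max_right _ _).trans ht) ((le_max_left _ _).trans ht) ?_
    obtain ⟨l, rfl⟩ : ∃ l, k = l + 1 := ⟨k - 1, by omega⟩
    rw [Lfun, Lfun, aMat_mulVec_image_latticeOf, (hv t).succMin_eq (by omega),
      (hv t).succMin_eq hkd]
    exact congrArg Real.log heq
  obtain ⟨W, hW⟩ := exists_forall_hasGapAt hkd.le hgap
  obtain ⟨-, -, w, -, hw, hli, hspan, -, -⟩ := hW _ le_rfl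
  have hH := H W (fun j : Fin k => w j) (fun j => hw j (by omega))
    (by rw [range_fin_eq_image_Iio, hspan]) (by rw [← hspan, finrank_span_image_Iio hkd.le hli])
  obtain ⟨I, -, hI, hμ⟩ : ∃ I : Finset (Fin (m + n)), I.card = k ∧
      gramCoeff (fun j : Fin k => w j) I ≠ 0 ∧ 1 < Real.exp (muI m ω I) := by
    by_contra! hall
    refine hH.not_ge (Real.sSup_le ?_ zero_le_one)
    rintro _ ⟨I, hIk, hI, rfl⟩
    exact hall I hIk hI
  rw [Real.one_lt_exp_iff] at hμ
  obtain ⟨c, hc, hbound⟩ := exists_le_abs_gramCoeff hkd.le hg hw hli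
  have hcI : 0 < c * |gramCoeff (fun j : Fin k => w j) I| := mul_pos hc (abs_pos.2 hI)
  set C := c * |gramCoeff (fun j : Fin k => w j) I|
  have hgrow : ∀ t ≥ max T 0, Real.exp (muI m ω I * t) * C ≤
      k.factorial * ∏ j ∈ Finset.range k, ‖v t j‖ := fun t ht => by
    have h1 := hbound (fun j : Fin k => aMat m ω (-t) *ᵥ v t j)
      (fun j => aMat_neg_mulVec_mem_latticeOf (hv t j (by omega)).1)
      (linearIndependent_aMat_mulVec (-t) ((hv t).linearIndependent.comp (Fin.castLE hkd.le)
        (Fin.castLE_injective hkd.le)))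
      (fun j => by rw [hspan]; exact (hW t ht).aMat_neg_mulVec_mem hkd.le (hv t) j.2) I
    have h2 := gramCoeff_aMat_mulVec m ω t (fun j : Fin k => aMat m ω (-t) *ᵥ v t j) I
    simp_rw [aMat_mulVec_aMat_neg_mulVec] at h2
    have h3 := abs_gramCoeff_le (fun j : Fin k => v t j) I
    rw [h2, abs_mul, Real.abs_exp, Fin.prod_univ_eq_prod_range (fun j => ‖v t j‖) k] at h3
    exact (mul_le_mul_of_nonneg_left h1 (Real.exp_pos _).le).trans h3
  have hbig : Filter.Tendsto (fun t => Real.exp (muI m ω I * t) * C) Filter.atTop Filter.atTop :=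
    (Real.tendsto_exp_atTop.comp (Filter.tendsto_id.const_mul_atTop hμ)).atTop_mul_const hcI
  obtain ⟨t, ht, hTt⟩ := ((hbig.eventually_gt_atTop
    (k.factorial * ((m + n : ℕ) : ℝ) ^ (m + n))).and (Filter.eventually_ge_atTop (max T 0))).exists
  have hlt : ((m + n : ℕ) : ℝ) ^ (m + n) < ∏ j ∈ Finset.range k, ‖v t j‖ :=
    lt_of_mul_lt_mul_left (ht.trans_le (hgrow t hTt)) (by positivity)
  have hone : (1 : ℝ) ≤ ((m + n : ℕ) : ℝ) ^ (m + n) :=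
    one_le_pow₀ (by exact_mod_cast (by omega : 1 ≤ m + n))
  have hle := prod_range_le_prod_range_of_one_lt hkd.le (fun i _ => norm_nonneg (v t i))
    (fun i j hij hj => (hv t).norm_le hij hj) (hone.trans_lt hlt)
  have hmink := (hv t).prod_norm_le (hdet t)
  rw [Fin.prod_univ_eq_prod_range (fun j => ‖v t j‖) (m + n)] at hmink
  linarith

end
end

section
/- Let d = m + n ≥ 2, let ω be an (m,n)-weight vector, let k ∈ {1,…,d−1}, let a,b ∈ ℝ, and let W ⊂ ℝ^d be a k-dimensional linear subspace. Then the k-pencil P^ω_{W,a,b} is a Zariski closed subset of M_{m,n}(ℝ). -/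
open scoped Classical
open MeasureTheory Module Matrix

noncomputable section

namespace IsZariskiClosed

variable {m n : ℕ}

theorem iInter {ι : Type*} {S : ι → Set (Matrix (Fin m) (Fin n) ℝ)}
    (h : ∀ i, IsZariskiClosed (S i)) : IsZariskiClosed (⋂ i, S i) := by
  choose P hP using h
  refine ⟨⋃ i, P i, ?_⟩
  ext x
  simp only [Set.mem_iInter, Set.mem_iUnion, Set.mem_ofPred_eq]
  constructor
  · rintro hx p ⟨i, hp⟩
    have := hx i
    rw [hP i] at this
    exact this p hp
  · intro hx i
    rw [hP i]
    exact fun p hp => hx p ⟨i, hp⟩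

theorem inter {S T : Set (Matrix (Fin m) (Fin n) ℝ)}
    (hS : IsZariskiClosed S) (hT : IsZariskiClosed T) : IsZariskiClosed (S ∩ T) := by
  rw [Set.inter_eq_iInter]
  exact iInter (by rintro (_ | _) <;> assumption)

theorem empty : IsZariskiClosed (∅ : Set (Matrix (Fin m) (Fin n) ℝ)) :=
  ⟨{1}, by simp⟩

theorem union {S T : Set (Matrix (Fin m) (Fin n) ℝ)}
    (hS : IsZariskiClosed S) (hT : IsZariskiClosed T) : IsZariskiClosed (S ∪ T) := by
  obtain ⟨P, rfl⟩ := hS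
  obtain ⟨Q, rfl⟩ := hT
  refine ⟨Set.image2 (· * ·) P Q, ?_⟩
  ext x
  simp only [Set.mem_union, Set.mem_ofPred_eq, Set.forall_mem_image2, map_mul, mul_eq_zero]
  constructor
  · rintro (h | h) p hp q hq
    exacts [Or.inl (h p hp), Or.inr (h q hq)]
  · intro h
    by_contra! hc
    obtain ⟨⟨p, hp, hp'⟩, q, hq, hq'⟩ := hc
    exact (h p hp q hq).elim hp' hq'

theorem biUnion_of_finite {ι : Type*} {I : Set ι} (hI : I.Finite)
    {S : ι → Set (Matrix (Fin m) (Fin n) ℝ)} (h : ∀ i, IsZariskiClosed (S i)) :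
    IsZariskiClosed (⋃ i ∈ I, S i) := by
  induction I, hI using Set.Finite.induction_on with
  | empty => simpa using empty
  | insert _ _ ih =>
    rw [Set.biUnion_insert]
    exact (h _).union ih

/-- A set that is downward closed with respect to finitely many bounded `ℕ`-valued functions with
Zariski closed sublevel sets is Zariski closed. -/
theorem of_forall_le {ι : Type*} [Finite ι] (r : ι → Matrix (Fin m) (Fin n) ℝ → ℕ) (N : ℕ)
    (hN : ∀ i x, r i x ≤ N) (hr : ∀ i c, IsZariskiClosed {x | r i x ≤ c})
    {S : Set (Matrix (Fin m) (Fin n) ℝ)}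
    (hS : ∀ x y, (∀ i, r i x ≤ r i y) → y ∈ S → x ∈ S) : IsZariskiClosed S := by
  have hfin : ((fun y i => r i y) '' S).Finite :=
    (Set.Finite.pi' fun _ : ι => Set.finite_Iic N).subset (by rintro _ ⟨y, -, rfl⟩ i; exact hN i y)
  have : S = ⋃ ρ ∈ (fun y i => r i y) '' S, ⋂ i, {x | r i x ≤ ρ i} := by
    ext x
    simp only [Set.mem_iUnion, Set.mem_iInter, Set.mem_ofPred_eq, Set.exists_mem_image, exists_prop]
    exact ⟨fun hx => ⟨x, hx, fun _ => le_rfl⟩, fun ⟨y, hy, hxy⟩ => hS x y hxy hy⟩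
  rw [this]
  exact biUnion_of_finite hfin fun ρ => iInter fun i => hr i (ρ i)

end IsZariskiClosed

theorem finrank_map_add_finrank_inf_ker {E F : Type*} [AddCommGroup E] [Module ℝ E]
    [FiniteDimensional ℝ E] [AddCommGroup F] [Module ℝ F] (A : Submodule ℝ E) (f : E →ₗ[ℝ] F) :
    finrank ℝ (A.map f) + finrank ℝ ↥(A ⊓ LinearMap.ker f) = finrank ℝ A := by
  rw [← (f.domRestrict A).finrank_range_add_finrank_ker, LinearMap.range_domRestrict,
    LinearMap.ker_domRestrict, ← Submodule.map_comap_subtype, Submodule.finrank_map_subtype_eq]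

theorem finrank_le_finrank_inf_ker_add_one {E : Type*} [AddCommGroup E] [Module ℝ E]
    [FiniteDimensional ℝ E] (A : Submodule ℝ E) (f : E →ₗ[ℝ] ℝ) :
    finrank ℝ A ≤ finrank ℝ ↥(A ⊓ LinearMap.ker f) + 1 := by
  have := finrank_map_add_finrank_inf_ker A f
  have := (A.map f).finrank_le
  rw [finrank_self] at this
  omega

theorem mem_Espan {d j : ℕ} {v : Fin d → ℝ} :
    v ∈ Espan d j ↔ ∀ i : Fin d, j ≤ (i : ℕ) → v i = 0 := by
  constructor
  · intro hv
    induction hv using Submodule.span_induction with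
    | mem x hx =>
      obtain ⟨i, hi, rfl⟩ := hx
      intro k hk
      exact Pi.single_eq_of_ne (by rintro rfl; omega) _
    | zero => simp
    | add x y _ _ hx hy => intro i hi; simp [hx i hi, hy i hi]
    | smul c x _ hx => intro i hi; simp [hx i hi]
  · intro h
    rw [pi_eq_sum_univ' v]
    refine Submodule.sum_mem _ fun i _ => ?_
    by_cases hi : (i : ℕ) < j
    · refine Submodule.smul_mem _ _ (Submodule.subset_span ⟨i, hi, ?_⟩)
      ext k; simp [Pi.single_apply, eq_comm]
    · simp [h i (not_lt.mp hi)]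

theorem mem_Eprime {m j : ℕ} {v : Fin m → ℝ} :
    v ∈ Eprime m j ↔ ∀ i : Fin m, (i : ℕ) < j → v i = 0 := by
  constructor
  · intro hv
    induction hv using Submodule.span_induction with
    | mem x hx =>
      obtain ⟨i, hi, rfl⟩ := hx
      intro k hk
      exact Pi.single_eq_of_ne (by rintro rfl; omega) _
    | zero => simp
    | add x y _ _ hx hy => intro i hi; simp [hx i hi, hy i hi]
    | smul c x _ hx => intro i hi; simp [hx i hi]
  · intro h
    rw [pi_eq_sum_univ' v]
    refine Submodule.sum_mem _ fun i _ => ?_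
    by_cases hi : j ≤ (i : ℕ)
    · refine Submodule.smul_mem _ _ (Submodule.subset_span ⟨i, hi, ?_⟩)
      ext k; simp [Pi.single_apply, eq_comm]
    · simp [h i (not_le.mp hi)]

theorem Espan_mono {d : ℕ} {i j : ℕ} (h : i ≤ j) : Espan d i ≤ Espan d j := by
  intro v hv
  rw [mem_Espan] at hv ⊢
  exact fun k hk => hv k (h.trans hk)

theorem Eprime_anti {m : ℕ} {i j : ℕ} (h : i ≤ j) : Eprime m j ≤ Eprime m i := by
  intro v hv
  rw [mem_Eprime] at hv ⊢
  exact fun k hk => hv k (hk.trans_le h)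

theorem ker_coordProj_eq_Eprime (m j : ℕ) :
    LinearMap.ker (coordProj m (Finset.univ.filter fun i : Fin m => (i : ℕ) < j)) =
      Eprime m j := by
  ext v
  rw [LinearMap.mem_ker, mem_Eprime, funext_iff]
  simp [coordProj]

theorem finrank_inf_Espan_succ_le {d : ℕ} (V : Submodule ℝ (Fin d → ℝ)) (i : Fin d) :
    finrank ℝ ↥(V ⊓ Espan d (i + 1)) ≤ finrank ℝ ↥(V ⊓ Espan d i) + 1 := by
  suffices h : V ⊓ Espan d i = V ⊓ Espan d (i + 1) ⊓ LinearMap.ker (LinearMap.proj i) by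
    rw [h]
    exact finrank_le_finrank_inf_ker_add_one _ _
  ext v
  simp only [Submodule.mem_inf, mem_Espan, LinearMap.mem_ker, LinearMap.proj_apply, and_assoc]
  refine and_congr_right fun _ => ⟨fun h => ⟨fun k hk => h k (by omega), h i le_rfl⟩, ?_⟩
  rintro ⟨h, hi⟩ k hk
  obtain hk | hk := hk.eq_or_lt
  · rwa [← Fin.ext hk]
  · exact h k hk

theorem finrank_inf_Eprime_le {m : ℕ} (V : Submodule ℝ (Fin m → ℝ)) (j : Fin m) :
    finrank ℝ ↥(V ⊓ Eprime m j) ≤ finrank ℝ ↥(V ⊓ Eprime m (j + 1)) + 1 := by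
  suffices h : V ⊓ Eprime m (j + 1) = V ⊓ Eprime m j ⊓ LinearMap.ker (LinearMap.proj j) by
    rw [h]
    exact finrank_le_finrank_inf_ker_add_one _ _
  ext v
  simp only [Submodule.mem_inf, mem_Eprime, LinearMap.mem_ker, LinearMap.proj_apply, and_assoc]
  refine and_congr_right fun _ => ⟨fun h => ⟨fun k hk => h k (by omega), h j (by omega)⟩, ?_⟩
  rintro ⟨h, hj⟩ k hk
  obtain hk | hk := (Nat.lt_succ_iff.mp hk).eq_or_lt
  · rwa [Fin.ext hk]
  · exact h k hk

theorem mul_le_sum_mul_sub {N : ℕ} (w : Fin N → ℝ) (hw : Antitone w) (t : ℕ → ℝ) (h0 : t 0 = 0)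
    (ht : ∀ i, 0 ≤ t i) (c : ℝ) (hc : ∀ i, c ≤ w i) :
    c * t N ≤ ∑ i : Fin N, w i * (t (i + 1) - t i) := by
  induction N generalizing c with
  | zero => simp [h0]
  | succ N ih =>
    rw [Fin.sum_univ_castSucc]
    have := ih (fun i => w i.castSucc) (fun i j h => hw (by simpa using h)) (w (Fin.last N))
      (fun i => hw (Fin.le_last _))
    have := mul_le_mul_of_nonneg_right (hc (Fin.last N)) (ht (N + 1))
    simp only [Fin.val_castSucc, Fin.val_last]
    linarith

theorem sum_ite_step_le {N : ℕ} (w : Fin N → ℝ) (hw : Antitone w) (hw0 : ∀ i, 0 ≤ w i)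
    (s t : ℕ → ℕ) (hs0 : s 0 = 0) (ht0 : t 0 = 0) (hst : ∀ i, s i ≤ t i)
    (hs : ∀ i : Fin N, s i ≤ s (i + 1) ∧ s (i + 1) ≤ s i + 1)
    (ht : ∀ i : Fin N, t i ≤ t (i + 1) ∧ t (i + 1) ≤ t i + 1) :
    (∑ i : Fin N, if s i < s (i + 1) then w i else 0) ≤
      ∑ i : Fin N, if t i < t (i + 1) then w i else 0 := by
  have key : ∀ s : ℕ → ℕ, (∀ i : Fin N, s i ≤ s (i + 1) ∧ s (i + 1) ≤ s i + 1) →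
      (∑ i : Fin N, if s i < s (i + 1) then w i else 0) =
        ∑ i : Fin N, w i * ((s (i + 1) : ℝ) - s i) := by
    intro s hs
    refine Finset.sum_congr rfl fun i _ => ?_
    split_ifs with h
    · have : s (i + 1) = s i + 1 := le_antisymm (hs i).2 h
      simp [this]
    · have : s (i + 1) = s i := le_antisymm (not_lt.mp h) (hs i).1
      simp [this]
  rw [key s hs, key t ht, ← sub_nonneg, ← Finset.sum_sub_distrib]
  have := mul_le_sum_mul_sub w hw (fun i => (t i : ℝ) - s i) (by simp [hs0, ht0])
    (fun i => sub_nonneg.mpr (by exact_mod_cast hst i)) 0 hw0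
  rw [zero_mul] at this
  refine this.trans_eq (Finset.sum_congr rfl fun i _ => by ring)

theorem psiF_eq_sum {m n : ℕ} (ω : Fin (m + n) → ℝ) (V : Submodule ℝ (Fin (m + n) → ℝ)) :
    psiF m ω V = ∑ i : Fin n, if finrank ℝ ↥(V ⊓ Espan (m + n) (m + i)) <
      finrank ℝ ↥(V ⊓ Espan (m + n) (m + (i + 1))) then ω (Fin.natAdd m i) else 0 := by
  rw [psiF, Iset, Finset.sum_filter, Fin.sum_univ_add]
  simp [Nat.not_le.mpr (Fin.is_lt _)]
  rfl

theorem psiF_le_psiF {m n : ℕ} {ω : Fin (m + n) → ℝ} (hω : IsWeightVector m n ω)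
    {V V' : Submodule ℝ (Fin (m + n) → ℝ)} (hV : V ⊓ Espan (m + n) m = ⊥)
    (hV' : V' ⊓ Espan (m + n) m = ⊥)
    (h : ∀ i, finrank ℝ ↥(V ⊓ Espan (m + n) i) ≤ finrank ℝ ↥(V' ⊓ Espan (m + n) i)) :
    psiF m ω V ≤ psiF m ω V' := by
  have step (V : Submodule ℝ (Fin (m + n) → ℝ)) (i : Fin n) :=
    And.intro (Submodule.finrank_mono (inf_le_inf_left V
      (Espan_mono (d := m + n) (Nat.le_succ (m + i)))))
      (finrank_inf_Espan_succ_le V (Fin.natAdd m i))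
  rw [psiF_eq_sum, psiF_eq_sum]
  exact sum_ite_step_le (fun i => ω (Fin.natAdd m i))
    (fun i j hij => hω.2.2.1 _ _ (by simp) (by simpa using hij)) (fun i => (hω.1 _).le)
    (fun i => finrank ℝ ↥(V ⊓ Espan (m + n) (m + i)))
    (fun i => finrank ℝ ↥(V' ⊓ Espan (m + n) (m + i)))
    (by simp [hV]) (by simp [hV']) (fun i => h _) (step V) (step V')

/-- The rank of the projection of `V` to the first `j` coordinates. -/
def headRank {m : ℕ} (V : Submodule ℝ (Fin m → ℝ)) (j : ℕ) : ℕ :=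
  finrank ℝ (V.map (coordProj m (Finset.univ.filter fun i : Fin m => (i : ℕ) < j)))

theorem headRank_add {m : ℕ} (V : Submodule ℝ (Fin m → ℝ)) (j : ℕ) :
    headRank V j + finrank ℝ ↥(V ⊓ Eprime m j) = finrank ℝ V := by
  rw [← ker_coordProj_eq_Eprime]
  exact finrank_map_add_finrank_inf_ker _ _

theorem headRank_zero {m : ℕ} (V : Submodule ℝ (Fin m → ℝ)) : headRank V 0 = 0 := by
  have h : Eprime m 0 = ⊤ := by ext; simp [mem_Eprime]
  have := headRank_add V 0
  rw [h, inf_top_eq] at this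
  omega

theorem phiF_le_phiF {m n : ℕ} {ω : Fin (m + n) → ℝ} (hω : IsWeightVector m n ω)
    {V V' : Submodule ℝ (Fin m → ℝ)} (h : ∀ j, headRank V j ≤ headRank V' j) :
    phiF m n ω V ≤ phiF m n ω V' := by
  have eq (V : Submodule ℝ (Fin m → ℝ)) : phiF m n ω V = ∑ j : Fin m,
      if headRank V j < headRank V (j + 1) then ω (Fin.castAdd n j) else 0 := by
    rw [phiF, Jset, Finset.sum_filter]
    refine Finset.sum_congr rfl fun j _ => if_congr ?_ rfl rfl
    have := headRank_add V j
    have := headRank_add V (j + 1)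
    omega
  have step (V : Submodule ℝ (Fin m → ℝ)) (j : Fin m) :
      headRank V j ≤ headRank V (j + 1) ∧ headRank V (j + 1) ≤ headRank V j + 1 := by
    have := headRank_add V j
    have := headRank_add V (j + 1)
    have := finrank_inf_Eprime_le V j
    have := Submodule.finrank_mono (inf_le_inf_left V (Eprime_anti (m := m) (Nat.le_succ j)))
    simp only [Nat.succ_eq_add_one] at this
    omega
  rw [eq, eq]
  exact sum_ite_step_le (fun j => ω (Fin.castAdd n j))
    (fun i j hij => hω.2.1 _ _ (Fin.le_def.mpr (by simpa using hij)) (by simp)) (fun i => (hω.1 _).le)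
    (headRank V) (headRank V') (headRank_zero V) (headRank_zero V') h (step V) (step V')

theorem xTil_castAdd (m n : ℕ) (x : Matrix (Fin m) (Fin n) ℝ) (i j : Fin m) :
    xTil m n x i (Fin.castAdd n j) = (1 : Matrix (Fin m) (Fin m) ℝ) i j := by
  simp [xTil, uMat]

theorem xTil_natAdd (m n : ℕ) (x : Matrix (Fin m) (Fin n) ℝ) (i : Fin m) (j : Fin n) :
    xTil m n x i (Fin.natAdd m j) = x i j := by
  simp [xTil, uMat]

theorem kerXtil_inf_Espan (m n : ℕ) (x : Matrix (Fin m) (Fin n) ℝ) :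
    kerXtil m n x ⊓ Espan (m + n) m = ⊥ := by
  rw [eq_bot_iff]
  rintro v ⟨hv, hv'⟩
  rw [SetLike.mem_coe, mem_Espan] at hv'
  have hnat : ∀ j : Fin n, v (Fin.natAdd m j) = 0 := fun j => hv' _ (by simp)
  have hcast : ∀ i : Fin m, v (Fin.castAdd n i) = 0 := by
    intro i
    have := congrFun (LinearMap.mem_ker.mp hv) i
    simpa [Matrix.mulVec, dotProduct, Fin.sum_univ_add, xTil_castAdd, hnat, Matrix.one_apply]
      using this
  rw [Submodule.mem_bot]
  ext i
  exact Fin.addCases hcast hnat i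

theorem exists_eval_eq_det (m n : ℕ) {r : ℕ} (B : Matrix (Fin r) (Fin m) ℝ)
    (C : Matrix (Fin (m + n)) (Fin r) ℝ) :
    ∃ p : MvPolynomial (Fin m × Fin n) ℝ, ∀ x : Matrix (Fin m) (Fin n) ℝ,
      MvPolynomial.eval (fun ij => x ij.1 ij.2) p = (B * xTil m n x * C).det := by
  have hX : ∀ i j, ∃ p : MvPolynomial (Fin m × Fin n) ℝ, ∀ x : Matrix (Fin m) (Fin n) ℝ,
      MvPolynomial.eval (fun ij => x ij.1 ij.2) p = xTil m n x i j := by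
    intro i j
    induction j using Fin.addCases with
    | left j => exact ⟨MvPolynomial.C ((1 : Matrix (Fin m) (Fin m) ℝ) i j),
        fun x => by rw [xTil_castAdd, MvPolynomial.eval_C]⟩
    | right j => exact ⟨MvPolynomial.X (i, j), fun x => by rw [xTil_natAdd, MvPolynomial.eval_X]⟩
  choose X hX using hX
  let c : ℝ →+* MvPolynomial (Fin m × Fin n) ℝ := MvPolynomial.C
  refine ⟨(B.map c * Matrix.of X * C.map c).det, fun x => ?_⟩
  rw [RingHom.map_det]
  congr 1
  ext i j
  simp [Matrix.mul_apply, hX, c]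

/-- The rank of a linear map on a subspace is at most `r` iff all its compressions to size `r + 1`
are singular. -/
theorem finrank_map_le_iff {p q r : ℕ} (A : Matrix (Fin p) (Fin q) ℝ)
    (U : Submodule ℝ (Fin q → ℝ)) :
    finrank ℝ (U.map A.mulVecLin) ≤ r ↔
      ∀ (B : Matrix (Fin (r + 1)) (Fin p) ℝ) (C : Matrix (Fin q) (Fin (r + 1)) ℝ),
        (∀ j, C.col j ∈ U) → (B * A * C).det = 0 := by
  constructor
  · intro h B C hC
    by_contra hdet
    have hli : LinearIndependent ℝ (B * A * C).col :=
      Matrix.linearIndependent_cols_iff_isUnit.mpr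
        ((Matrix.isUnit_iff_isUnit_det _).mpr (isUnit_iff_ne_zero.mpr hdet))
    have hcol : (B * A * C).col = B.mulVecLin ∘ fun j => A.mulVecLin (C.col j) := by
      ext j i
      simp only [Function.comp, Matrix.mulVecLin_apply, Matrix.mulVec_mulVec]
      rfl
    rw [hcol] at hli
    have hli' : LinearIndependent ℝ
        fun j => (⟨_, Submodule.mem_map_of_mem (hC j)⟩ : U.map A.mulVecLin) :=
      LinearIndependent.of_comp (U.map A.mulVecLin).subtype hli.of_comp
    have := hli'.fintype_card_le_finrank
    rw [Fintype.card_fin] at this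
    omega
  · intro h
    by_contra! hr
    obtain ⟨v, hv⟩ := exists_linearIndependent_of_le_finrank hr
    choose c hcU hc using fun j => Submodule.mem_map.mp (v j).2
    have hv' := hv.map' _ (Submodule.ker_subtype _)
    set C : Matrix (Fin q) (Fin (r + 1)) ℝ := Matrix.of fun i j => c j i
    have hAC : LinearIndependent ℝ (A * C).col := by
      have hcol : (A * C).col = (U.map A.mulVecLin).subtype ∘ v := by
        ext j i
        simp [C, ← hc, Matrix.mul_apply, Matrix.mulVec, dotProduct]
      rwa [hcol]
    obtain ⟨g, hg⟩ := (A * C).mulVecLin.exists_leftInverse_of_injective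
      (LinearMap.ker_eq_bot.mpr (Matrix.mulVec_injective_iff.mpr hAC))
    have hB : LinearMap.toMatrix' g * (A * C) = 1 := by
      rw [← LinearMap.toMatrix'_id, ← hg, LinearMap.toMatrix'_comp, ← Matrix.toLin'_apply',
        LinearMap.toMatrix'_toLin']
    have := h (LinearMap.toMatrix' g) C hcU
    rw [Matrix.mul_assoc, hB, Matrix.det_one] at this
    exact one_ne_zero this

theorem isZariskiClosed_finrank_map_le (m n r : ℕ) (T : (Fin m → ℝ) →ₗ[ℝ] (Fin m → ℝ))
    (U : Submodule ℝ (Fin (m + n) → ℝ)) :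
    IsZariskiClosed {x | finrank ℝ ((U.map (xTil m n x).mulVecLin).map T) ≤ r} := by
  choose p hp using fun B : Matrix (Fin (r + 1)) (Fin m) ℝ => exists_eval_eq_det m n (r := r + 1) B
  refine ⟨{q | ∃ (B : Matrix (Fin (r + 1)) (Fin m) ℝ) (C : Matrix (Fin (m + n)) (Fin (r + 1)) ℝ),
    (∀ j, C.col j ∈ U) ∧ q = p (B * LinearMap.toMatrix' T) C}, ?_⟩
  ext x
  have : (U.map (xTil m n x).mulVecLin).map T =
      U.map (LinearMap.toMatrix' T * xTil m n x).mulVecLin := by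
    rw [Matrix.mulVecLin_mul, Submodule.map_comp, ← Matrix.toLin'_apply' (LinearMap.toMatrix' T),
      Matrix.toLin'_toMatrix']
  rw [Set.mem_ofPred_eq, this, finrank_map_le_iff]
  constructor
  · rintro h _ ⟨B, C, hC, rfl⟩
    rw [hp, Matrix.mul_assoc B]
    exact h B C hC
  · intro h B C hC
    rw [← Matrix.mul_assoc B, ← hp]
    exact h _ ⟨B, C, hC, rfl⟩

theorem isZariskiClosed_le_psiF {m n : ℕ} {ω : Fin (m + n) → ℝ} (hω : IsWeightVector m n ω)
    (a : ℝ) (W : Submodule ℝ (Fin (m + n) → ℝ)) :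
    IsZariskiClosed {x | a ≤ psiF m ω (kerXtil m n x ⊓ W)} := by
  refine IsZariskiClosed.of_forall_le (ι := Fin (m + n + 1))
    (fun i x => finrank ℝ (((W ⊓ Espan (m + n) i).map (xTil m n x).mulVecLin).map LinearMap.id))
    m (fun i x => (Submodule.finrank_le _).trans_eq (by simp))
    (fun i c => isZariskiClosed_finrank_map_le m n c _ _) fun x y h hy => ?_
  have hbot (x) : kerXtil m n x ⊓ W ⊓ Espan (m + n) m = ⊥ := by
    rw [inf_right_comm, kerXtil_inf_Espan, bot_inf_eq]
  refine le_trans (Set.mem_ofPred.mp hy) (psiF_le_psiF hω (hbot y) (hbot x) fun i => ?_)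
  obtain ⟨i', hi'⟩ : ∃ i' : Fin (m + n + 1), Espan (m + n) i' = Espan (m + n) i := by
    refine ⟨⟨min i (m + n), by omega⟩, ?_⟩
    ext v
    simp only [mem_Espan]
    exact forall_congr' fun k => by simp [k.2.not_ge]
  have key (x) : finrank ℝ ((W ⊓ Espan (m + n) i).map (xTil m n x).mulVecLin) +
      finrank ℝ ↥(kerXtil m n x ⊓ W ⊓ Espan (m + n) i) = finrank ℝ ↥(W ⊓ Espan (m + n) i) := by
    rw [inf_assoc, inf_comm (kerXtil m n x)]
    exact finrank_map_add_finrank_inf_ker _ _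
  have hx := key x
  have hy := key y
  have h := h i'
  rw [hi', Submodule.map_id, Submodule.map_id] at h
  omega

theorem isZariskiClosed_phiF_le {m n : ℕ} {ω : Fin (m + n) → ℝ} (hω : IsWeightVector m n ω)
    (b : ℝ) (W : Submodule ℝ (Fin (m + n) → ℝ)) :
    IsZariskiClosed {x | phiF m n ω (W.map (xTil m n x).mulVecLin) ≤ b} := by
  refine IsZariskiClosed.of_forall_le (ι := Fin (m + 1))
    (fun j x => headRank (W.map (xTil m n x).mulVecLin) j)
    m (fun i x => (Submodule.finrank_le _).trans_eq (by simp))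
    (fun i c => isZariskiClosed_finrank_map_le m n c _ _) fun x y h hy => ?_
  refine le_trans (phiF_le_phiF hω fun j => ?_) (Set.mem_ofPred.mp hy)
  obtain ⟨j', hj'⟩ : ∃ j' : Fin (m + 1), ∀ V : Submodule ℝ (Fin m → ℝ),
      headRank V j' = headRank V j := by
    refine ⟨⟨min j m, by omega⟩, fun V => ?_⟩
    have hE : Eprime m (min j m) = Eprime m j := by
      ext v
      simp [mem_Eprime]
    have h1 := headRank_add V (min j m)
    have h2 := headRank_add V j
    rw [hE] at h1
    exact Nat.add_right_cancel (h1.trans h2.symm)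
  rw [← hj', ← hj']
  exact h j'

theorem pencil_isZariskiClosed
    (m n : ℕ) (hm : 0 < m) (hn : 0 < n) (hd : 2 ≤ m + n)
    (ω : Fin (m + n) → ℝ) (hω : IsWeightVector m n ω)
    (k : ℕ) (hk1 : 1 ≤ k) (hk2 : k ≤ m + n - 1) (a b : ℝ)
    (W : Submodule ℝ (Fin (m + n) → ℝ)) (hW : Module.finrank ℝ W = k) :
    IsZariskiClosed (pencil m n ω W a b) :=
  (isZariskiClosed_le_psiF hω a W).inter (isZariskiClosed_phiF_le hω b W)

end
end
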